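/- Let X be a one-sided subshift of finite type with metric d_θ, let φ : X → ℝ be a d_θ-Hölder potential whose equilibrium state μ satisfies the Gibbs property with constants c₁, c₂ > 0 and pressure P ≥ 0. Let δ > 0, m ∈ ℕ, and g : X → (0,∞) constant on every cylinder of length m with values in δℤ and g ≥ δ, and let (X_g, σ_g) be the discretised subshift with the measure μ̃^g transported to X_g (so that the μ̃^g-measure of the cylinder determined by a finite word w of X_g equals (δ/∫g dμ)·μ([π̃(w)]_{#w+1}), where #w is one plus the number of returns to fiber-level 0 in w). Then μ̃^g is a σ_g-invariant Borel probability measure on X_g, and it is a Gibbs measure (equilibrium state) for some d_θ-Hölder continuous potential ψ : X_g → ℝ: there exist a Hölder ψ, a constant P' ≥ 0 and constants C₁, C₂ > 0 such that C₁ ≤ μ̃^g([x̄]_k)/exp(−P'k + Σ_{i=0}^{k−1} ψ(σ_g^i x̄)) ≤ C₂ for all x̄ ∈ X_g and k ∈ ℕ. -/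

import Mathlib

open Filter Set MeasureTheory

noncomputable section

/-- The one-sided full shift map on sequences over the alphabet `Fin a`. -/
def shiftMap (a : ℕ) : (ℕ → Fin a) → (ℕ → Fin a) := fun x n => x (n + 1)

/-- The shift map on sequences over an arbitrary alphabet. -/
def shiftSeq {B : Type*} (u : ℕ → B) : ℕ → B := fun n => u (n + 1)

/-- The one-sided subshift of finite type determined by the 0-1 transition matrix `A`. -/
def SFT {a : ℕ} (A : Matrix (Fin a) (Fin a) ℕ) : Set (ℕ → Fin a) :=
  {x | ∀ n, A (x n) (x (n + 1)) = 1}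

/-- The cylinder of length `n` around `x`. -/
def cyl {a : ℕ} (x : ℕ → Fin a) (n : ℕ) : Set (ℕ → Fin a) := {y | ∀ i < n, y i = x i}

/-- The cylinder of length `k` around a sequence in an arbitrary sequence space. -/
def seqCyl {B : Type*} (u : ℕ → B) (k : ℕ) : Set (ℕ → B) := {v | ∀ i < k, v i = u i}

/-- The Birkhoff sum `S_m f(x) = Σ_{k<m} f(σ^k x)`. -/
def birkhoff {a : ℕ} (f : (ℕ → Fin a) → ℝ) (m : ℕ) (x : ℕ → Fin a) : ℝ :=
  ∑ k ∈ Finset.range m, f ((shiftMap a)^[k] x)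

open Classical in
/-- The metric `d_θ` on a sequence space. -/
def dSeq {B : Type*} (θ : ℝ) (u v : ℕ → B) : ℝ :=
  if u = v then 0 else θ ^ sInf {n | u n ≠ v n}

/-- The discrete suspension space `Λ̃_g`. -/
def discSusp {a : ℕ} (X : Set (ℕ → Fin a)) (g : (ℕ → Fin a) → ℝ) (δ : ℝ) :
    Set ((ℕ → Fin a) × ℤ) :=
  {p | p.1 ∈ X ∧ 0 ≤ p.2 ∧ ((p.2 : ℤ) : ℝ) < g p.1 / δ}

open Classical in
/-- The discrete suspension map `T_g`. -/
def discT {a : ℕ} (g : (ℕ → Fin a) → ℝ) (δ : ℝ) (p : (ℕ → Fin a) × ℤ) :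
    (ℕ → Fin a) × ℤ :=
  if ((p.2 + 1 : ℤ) : ℝ) < g p.1 / δ then (p.1, p.2 + 1) else (shiftMap a p.1, 0)

/-- The discrete suspension measure `μ̃^g = (δ/∫g dμ)·(μ × counting)` on `Λ̃_g`. -/
def discMeasure {a : ℕ} (μ : Measure (ℕ → Fin a)) [SFinite μ] (X : Set (ℕ → Fin a))
    (g : (ℕ → Fin a) → ℝ) (δ : ℝ) : Measure ((ℕ → Fin a) × ℤ) :=
  (ENNReal.ofReal (δ / ∫ x, g x ∂μ)) •
    ((μ.prod (Measure.count : Measure ℤ)).restrict (discSusp X g δ))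

/-- A word is allowed if it occurs as an initial segment of a point of `X`. -/
def wordOK {a m : ℕ} (A : Matrix (Fin a) (Fin a) ℕ) (W : Fin m → Fin a) : Prop :=
  ∃ x ∈ SFT A, ∀ i : Fin m, x (i : ℕ) = W i

/-- The canonical extension of a word of positive length `m` to a sequence. -/
def extendW {a m : ℕ} (hm : 0 < m) (W : Fin m → Fin a) : ℕ → Fin a :=
  fun n => if h : n < m then W ⟨n, h⟩ else W ⟨0, hm⟩

/-- Allowed transitions of the discretised subshift `X_g`. -/
def transOK {a m : ℕ} (A : Matrix (Fin a) (Fin a) ℕ) (g : (ℕ → Fin a) → ℝ) (δ : ℝ)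
    (hm : 0 < m) (u v : (Fin m → Fin a) × ℕ) : Prop :=
  (v.1 = u.1 ∧ v.2 = u.2 + 1 ∧ ((u.2 + 1 : ℕ) : ℝ) < g (extendW hm u.1) / δ) ∨
  (((u.2 + 1 : ℕ) : ℝ) = g (extendW hm u.1) / δ ∧ v.2 = 0 ∧
    (∀ i : ℕ, ∀ (h1 : i + 1 < m) (h2 : i < m), v.1 ⟨i, h2⟩ = u.1 ⟨i + 1, h1⟩) ∧
    (∃ x ∈ SFT A, (∀ i : Fin m, x (i : ℕ) = u.1 i) ∧ x m = v.1 ⟨m - 1, Nat.sub_lt hm Nat.one_pos⟩))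

/-- The discretised subshift of finite type `X_g`. -/
def Xg {a m : ℕ} (A : Matrix (Fin a) (Fin a) ℕ) (g : (ℕ → Fin a) → ℝ) (δ : ℝ)
    (hm : 0 < m) : Set (ℕ → ((Fin m → Fin a) × ℕ)) :=
  {y | ∀ n, wordOK A (y n).1 ∧ (((y n).2 : ℕ) : ℝ) < g (extendW hm (y n).1) / δ ∧
        transOK A g δ hm (y n) (y (n + 1))}

/-- The coding of a point of the discrete suspension by a symbol of the alphabet of `X_g`:
the length-`m` initial word of the base point together with the fiber level. -/
def code {a : ℕ} (m : ℕ) (p : (ℕ → Fin a) × ℤ) : (Fin m → Fin a) × ℕ :=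
  (fun i => p.1 (i : ℕ), p.2.toNat)

/-- The natural conjugacy `Λ̃_g → X_g`, sending a point to the coding of its `T_g`-orbit. -/
def conj {a : ℕ} (m : ℕ) (g : (ℕ → Fin a) → ℝ) (δ : ℝ) (p : (ℕ → Fin a) × ℤ) :
    ℕ → ((Fin m → Fin a) × ℕ) :=
  fun n => code m ((discT g δ)^[n] p)

/-- The number of visits of `u` to fiber level `0` at the times `1, …, n`. -/
def returnCount {B : Type*} (u : ℕ → B × ℕ) : ℕ → ℕ
  | 0 => 0
  | n + 1 => if (u (n + 1)).2 = 0 then returnCount u n + 1 else returnCount u n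

/-- The itinerary map `π̃`: the base coordinates of `u` read at successive visits to level `0`. -/
def itinerary {a m : ℕ} (hm : 0 < m) (u : ℕ → (Fin m → Fin a) × ℕ) : ℕ → Fin a :=
  fun l => (u (sInf {n | returnCount u n = l})).1 ⟨0, hm⟩

section ReturnCount

variable {B : Type*} {u v : ℕ → B × ℕ}

theorem returnCount_succ_of_eq {n : ℕ} (h : (u (n + 1)).2 = 0) :
    returnCount u (n + 1) = returnCount u n + 1 := by
  simp [returnCount, h]

theorem returnCount_succ_of_ne {n : ℕ} (h : (u (n + 1)).2 ≠ 0) :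
    returnCount u (n + 1) = returnCount u n := by
  simp [returnCount, h]

theorem returnCount_mono (u : ℕ → B × ℕ) : Monotone (returnCount u) := by
  refine monotone_nat_of_le_succ fun n => ?_
  by_cases h : (u (n + 1)).2 = 0
  · rw [returnCount_succ_of_eq h]; omega
  · rw [returnCount_succ_of_ne h]

theorem returnCount_succ_le (u : ℕ → B × ℕ) (n : ℕ) :
    returnCount u (n + 1) ≤ returnCount u n + 1 := by
  by_cases h : (u (n + 1)).2 = 0
  · rw [returnCount_succ_of_eq h]
  · rw [returnCount_succ_of_ne h]; omega

theorem returnCount_congr {k : ℕ} (h : ∀ i < k, u i = v i) :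
    ∀ n < k, returnCount u n = returnCount v n := by
  intro n hn
  induction n with
  | zero => rfl
  | succ n ih => simp only [returnCount, h _ hn, ih (by omega)]

theorem exists_returnCount_eq_of_lt {l : ℕ} :
    ∀ {k : ℕ}, l < returnCount u k →
      ∃ n < k, returnCount u n = l ∧ returnCount u (n + 1) = l + 1 := by
  intro k
  induction k with
  | zero => intro h; simp [returnCount] at h
  | succ k ih =>
    intro h
    by_cases hk : l < returnCount u k
    · obtain ⟨n, hn, h'⟩ := ih hk
      exact ⟨n, by omega, h'⟩
    · have := returnCount_succ_le u k
      exact ⟨k, by omega, by omega, by omega⟩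

theorem exists_returnCount_eq_of_le {k l : ℕ} (h : l ≤ returnCount u k) :
    ∃ n ≤ k, returnCount u n = l := by
  rcases h.lt_or_eq with h | h
  · obtain ⟨n, hn, h', -⟩ := exists_returnCount_eq_of_lt h
    exact ⟨n, hn.le, h'⟩
  · exact ⟨k, le_rfl, h.symm⟩

theorem iterate_shiftSeq_apply {B : Type*} (u : ℕ → B) (k n : ℕ) :
    shiftSeq^[k] u n = u (n + k) := by
  induction k generalizing u with
  | zero => rfl
  | succ k ih => rw [Function.iterate_succ_apply, ih]; simp [shiftSeq, add_assoc]

theorem iterate_shiftMap_apply {a : ℕ} (x : ℕ → Fin a) (k n : ℕ) :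
    (shiftMap a)^[k] x n = x (n + k) :=
  iterate_shiftSeq_apply x k n

theorem returnCount_iterate_shiftSeq (u : ℕ → B × ℕ) (k n : ℕ) :
    returnCount (shiftSeq^[k] u) n + returnCount u k = returnCount u (n + k) := by
  induction n with
  | zero => simp [returnCount]
  | succ n ih =>
    have e : n + 1 + k = (n + k) + 1 := by omega
    rw [e]
    simp only [returnCount, iterate_shiftSeq_apply, e, ← ih]
    split_ifs <;> omega

end ReturnCount

section Discretised

variable {a m : ℕ} {A : Matrix (Fin a) (Fin a) ℕ} {g : (ℕ → Fin a) → ℝ} {δ : ℝ} {hm : 0 < m}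
  {N : (ℕ → Fin a) → ℕ} {u : ℕ → (Fin m → Fin a) × ℕ}

theorem extendW_apply (hm : 0 < m) (W : Fin m → Fin a) (s : Fin m) : extendW hm W s = W s := by
  simp [extendW]

theorem extendW_prefix_apply (hm : 0 < m) (x : ℕ → Fin a) {i : ℕ} (hi : i < m) :
    extendW hm (fun s : Fin m => x s) i = x i := by
  simp [extendW, hi]

theorem shiftMap_mem_SFT {x : ℕ → Fin a} (hx : x ∈ SFT A) (k : ℕ) :
    (shiftMap a)^[k] x ∈ SFT A := by
  intro n
  simp only [iterate_shiftMap_apply]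
  have := hx (n + k)
  rwa [show n + 1 + k = n + k + 1 by omega]

theorem shiftSeq_mem_Xg (hu : u ∈ Xg A g δ hm) (k : ℕ) : shiftSeq^[k] u ∈ Xg A g δ hm := by
  intro n
  simp only [iterate_shiftSeq_apply]
  have := hu (n + k)
  rwa [show n + 1 + k = n + k + 1 by omega]

theorem level_lt_of_mem_Xg (hN : ∀ x, g x / δ = N x) (hu : u ∈ Xg A g δ hm) (n : ℕ) :
    (u n).2 < N (extendW hm (u n).1) := by
  have := (hu n).2.1
  rw [hN] at this
  exact_mod_cast this

theorem step_of_level_ne_zero (hN : ∀ x, g x / δ = N x) (hu : u ∈ Xg A g δ hm) {n : ℕ}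
    (h : (u (n + 1)).2 ≠ 0) :
    (u (n + 1)).1 = (u n).1 ∧ (u (n + 1)).2 = (u n).2 + 1 ∧
      (u n).2 + 1 < N (extendW hm (u n).1) := by
  rcases (hu n).2.2 with ⟨h1, h2, h3⟩ | ⟨-, h2, -⟩
  · rw [hN] at h3
    exact ⟨h1, h2, by exact_mod_cast h3⟩
  · exact absurd h2 h

theorem step_of_level_eq_zero (hN : ∀ x, g x / δ = N x) (hu : u ∈ Xg A g δ hm) {n : ℕ}
    (h : (u (n + 1)).2 = 0) :
    (u n).2 + 1 = N (extendW hm (u n).1) ∧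
      (∀ i : ℕ, ∀ (h1 : i + 1 < m) (h2 : i < m), (u (n + 1)).1 ⟨i, h2⟩ = (u n).1 ⟨i + 1, h1⟩) ∧
      ∃ x ∈ SFT A, (∀ i : Fin m, x i = (u n).1 i) ∧
        x m = (u (n + 1)).1 ⟨m - 1, Nat.sub_lt hm Nat.one_pos⟩ := by
  rcases (hu n).2.2 with ⟨-, h2, -⟩ | ⟨h1, -, h3⟩
  · omega
  · rw [hN] at h1
    exact ⟨by exact_mod_cast h1, h3⟩

/-- The time `n` is at most the number of returns times the maximal roof height, up to the level. -/
theorem le_returnCount_mul_add_level (hN : ∀ x, g x / δ = N x) {K : ℕ} (hK : ∀ x, N x ≤ K)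
    (hu : u ∈ Xg A g δ hm) (n : ℕ) : n ≤ returnCount u n * K + (u n).2 := by
  induction n with
  | zero => omega
  | succ n ih =>
    by_cases h : (u (n + 1)).2 = 0
    · have h1 := (step_of_level_eq_zero hN hu h).1
      have h2 := hK (extendW hm (u n).1)
      rw [returnCount_succ_of_eq h, h, add_mul]
      omega
    · have h1 := (step_of_level_ne_zero hN hu h).2.1
      rw [returnCount_succ_of_ne h]
      omega

theorem lt_returnCount_add_one_mul (hN : ∀ x, g x / δ = N x) {K : ℕ} (hK : ∀ x, N x ≤ K)
    (hu : u ∈ Xg A g δ hm) (n : ℕ) : n < (returnCount u n + 1) * K := by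
  have h1 := le_returnCount_mul_add_level hN hK hu n
  have h2 := level_lt_of_mem_Xg hN hu n
  have h3 := hK (extendW hm (u n).1)
  rw [add_mul]
  omega

theorem exists_returnCount_eq (hN : ∀ x, g x / δ = N x) {K : ℕ} (hK : ∀ x, N x ≤ K)
    (hu : u ∈ Xg A g δ hm) (l : ℕ) :
    ∃ n, returnCount u n = l ∧ returnCount u (n + 1) = l + 1 := by
  have h := lt_returnCount_add_one_mul hN hK hu ((l + 1) * K)
  have h' : l < returnCount u ((l + 1) * K) := by
    have := lt_of_mul_lt_mul_right h (Nat.zero_le K)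
    omega
  obtain ⟨n, -, hn⟩ := exists_returnCount_eq_of_lt h'
  exact ⟨n, hn⟩

theorem word_apply_eq_of_le (hN : ∀ x, g x / δ = N x) (hu : u ∈ Xg A g δ hm) {n n' : ℕ}
    (hn : n ≤ n') : ∀ s s' : Fin m, returnCount u n + s = returnCount u n' + s' →
      (u n).1 s = (u n').1 s' := by
  induction n', hn using Nat.le_induction with
  | base =>
    intro s s' h
    rw [show s = s' from Fin.ext (by omega)]
  | succ n' hn ih =>
    intro s s' h
    by_cases h0 : (u (n' + 1)).2 = 0
    · rw [returnCount_succ_of_eq h0] at h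
      have hmono := returnCount_mono u hn
      have hs' : (s' : ℕ) + 1 < m := by have := s.2; omega
      rw [(step_of_level_eq_zero hN hu h0).2.1 s' hs' s'.2]
      exact ih s ⟨s' + 1, hs'⟩ (by simp only; omega)
    · rw [returnCount_succ_of_ne h0] at h
      rw [(step_of_level_ne_zero hN hu h0).1]
      exact ih s s' h

theorem word_apply_eq (hN : ∀ x, g x / δ = N x) (hu : u ∈ Xg A g δ hm) {n n' : ℕ}
    (s s' : Fin m) (h : returnCount u n + s = returnCount u n' + s') :
    (u n).1 s = (u n').1 s' := by
  rcases le_total n n' with hn | hn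
  · exact word_apply_eq_of_le hN hu hn s s' h
  · exact (word_apply_eq_of_le hN hu hn s' s h.symm).symm

/-- The words of `u` are the windows of length `m` of its itinerary. -/
theorem word_apply_eq_itinerary (hN : ∀ x, g x / δ = N x) {K : ℕ} (hK : ∀ x, N x ≤ K)
    (hu : u ∈ Xg A g δ hm) (n : ℕ) (s : Fin m) :
    (u n).1 s = itinerary hm u (returnCount u n + s) := by
  obtain ⟨k, hk, -⟩ := exists_returnCount_eq hN hK hu (returnCount u n + s)
  have h : returnCount u (sInf {i | returnCount u i = returnCount u n + s}) =
      returnCount u n + s :=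
    Nat.sInf_mem (s := {i | returnCount u i = returnCount u n + s}) ⟨k, hk⟩
  exact word_apply_eq hN hu s ⟨0, hm⟩ (by simp only; omega)

theorem itinerary_unique (hN : ∀ x, g x / δ = N x) {K : ℕ} (hK : ∀ x, N x ≤ K)
    (hu : u ∈ Xg A g δ hm) {x : ℕ → Fin a}
    (hx : ∀ n, ∀ s : Fin m, (u n).1 s = x (returnCount u n + s)) : itinerary hm u = x := by
  funext l
  obtain ⟨n, hn, -⟩ := exists_returnCount_eq hN hK hu l
  have h1 := word_apply_eq_itinerary hN hK hu n ⟨0, hm⟩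
  have h2 := hx n ⟨0, hm⟩
  simp only [add_zero, hn] at h1 h2
  rw [← h1, h2]

theorem itinerary_mem_SFT (hN : ∀ x, g x / δ = N x) {K : ℕ} (hK : ∀ x, N x ≤ K)
    (hu : u ∈ Xg A g δ hm) : itinerary hm u ∈ SFT A := by
  intro l
  obtain ⟨n, hn, hn'⟩ := exists_returnCount_eq hN hK hu l
  have h0 : (u (n + 1)).2 = 0 := by
    by_contra h
    rw [returnCount_succ_of_ne h] at hn'
    omega
  obtain ⟨-, hover, z, hz, hzw, hzm⟩ := step_of_level_eq_zero hN hu h0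
  have h1 := word_apply_eq_itinerary hN hK hu n ⟨0, hm⟩
  have h2 := word_apply_eq_itinerary hN hK hu (n + 1) ⟨0, hm⟩
  simp only [add_zero, hn, hn'] at h1 h2
  have h3 : (u (n + 1)).1 ⟨0, hm⟩ = z 1 := by
    by_cases h : 0 + 1 < m
    · rw [hover 0 h hm, ← hzw]
    · obtain rfl : m = 1 := by omega
      exact hzm.symm
  rw [← h1, ← h2, h3, ← hzw]
  exact hz 0

theorem itinerary_iterate_shiftSeq (hN : ∀ x, g x / δ = N x) {K : ℕ} (hK : ∀ x, N x ≤ K)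
    (hu : u ∈ Xg A g δ hm) (k : ℕ) :
    itinerary hm (shiftSeq^[k] u) = (shiftMap a)^[returnCount u k] (itinerary hm u) := by
  refine itinerary_unique hN hK (shiftSeq_mem_Xg hu k) fun n s => ?_
  rw [iterate_shiftSeq_apply, iterate_shiftMap_apply, word_apply_eq_itinerary hN hK hu,
    ← returnCount_iterate_shiftSeq]
  congr 1
  omega

/-- Two windowings of `x` and `y` by `u` that agree before time `k + 1` force `x` and `y` to agree
on the first `m + returnCount u k` coordinates. -/
theorem eq_of_windows_eq {v : ℕ → (Fin m → Fin a) × ℕ} {x y : ℕ → Fin a} {k : ℕ}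
    (hx : ∀ n, ∀ s : Fin m, (u n).1 s = x (returnCount u n + s))
    (hy : ∀ n, ∀ s : Fin m, (v n).1 s = y (returnCount v n + s)) (hm : 0 < m)
    (h : ∀ n < k + 1, u n = v n) : ∀ i < m + returnCount u k, x i = y i := by
  intro i hi
  obtain ⟨n, hn, s, rfl⟩ : ∃ n ≤ k, ∃ s : Fin m, returnCount u n + s = i := by
    rcases le_total i (returnCount u k) with h' | h'
    · obtain ⟨n, hn, rfl⟩ := exists_returnCount_eq_of_le h'
      exact ⟨n, hn, ⟨0, hm⟩, rfl⟩
    · exact ⟨k, le_rfl, ⟨i - returnCount u k, by omega⟩, by simp only; omega⟩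
  rw [← hx, returnCount_congr h n (by omega), ← hy, h n (by omega)]

end Discretised

section Suspension

variable {a m : ℕ} {A : Matrix (Fin a) (Fin a) ℕ} {g : (ℕ → Fin a) → ℝ} {δ : ℝ} {hm : 0 < m}
  {N : (ℕ → Fin a) → ℕ}

theorem mem_discSusp_iff (hN : ∀ x, g x / δ = N x) {X : Set (ℕ → Fin a)} {y : ℕ → Fin a} {j : ℕ} :
    (y, (j : ℤ)) ∈ discSusp X g δ ↔ y ∈ X ∧ j < N y := by
  simp only [discSusp, mem_ofPred_eq, hN]
  norm_cast
  simp

theorem exists_natCast_of_mem_discSusp {X : Set (ℕ → Fin a)} {p : (ℕ → Fin a) × ℤ}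
    (hp : p ∈ discSusp X g δ) : ∃ y, ∃ j : ℕ, p = (y, (j : ℤ)) := by
  obtain ⟨j, hj⟩ := Int.eq_ofNat_of_zero_le hp.2.1
  exact ⟨p.1, j, Prod.ext rfl hj⟩

theorem discT_of_lt (hN : ∀ x, g x / δ = N x) {y : ℕ → Fin a} {j : ℕ} (h : j + 1 < N y) :
    discT g δ (y, (j : ℤ)) = (y, ((j + 1 : ℕ) : ℤ)) := by
  simp only [discT, hN]
  rw [if_pos (by exact_mod_cast h)]
  simp

theorem discT_of_eq (hN : ∀ x, g x / δ = N x) {y : ℕ → Fin a} {j : ℕ} (h : j + 1 = N y) :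
    discT g δ (y, (j : ℤ)) = (shiftMap a y, ((0 : ℕ) : ℤ)) := by
  simp only [discT, hN]
  rw [if_neg (by rw [← h]; push_cast; exact lt_irrefl _)]
  simp

theorem discT_mem_discSusp (hN : ∀ x, g x / δ = N x) (hN1 : ∀ x, 0 < N x)
    {p : (ℕ → Fin a) × ℤ} (hp : p ∈ discSusp (SFT A) g δ) :
    discT g δ p ∈ discSusp (SFT A) g δ := by
  obtain ⟨y, j, rfl⟩ := exists_natCast_of_mem_discSusp hp
  rw [mem_discSusp_iff hN] at hp
  rcases (Nat.succ_le_of_lt hp.2).lt_or_eq with h | h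
  · rw [discT_of_lt hN h, mem_discSusp_iff hN]
    exact ⟨hp.1, h⟩
  · rw [discT_of_eq hN h, mem_discSusp_iff hN]
    exact ⟨shiftMap_mem_SFT hp.1 1, hN1 _⟩

theorem iterate_discT_mem_discSusp (hN : ∀ x, g x / δ = N x) (hN1 : ∀ x, 0 < N x)
    {p : (ℕ → Fin a) × ℤ} (hp : p ∈ discSusp (SFT A) g δ) (n : ℕ) :
    (discT g δ)^[n] p ∈ discSusp (SFT A) g δ :=
  (show MapsTo (discT g δ) (discSusp (SFT A) g δ) (discSusp (SFT A) g δ) from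
    fun _ h => discT_mem_discSusp hN hN1 h).iterate n hp

theorem roof_extendW_prefix (hNm : ∀ x y : ℕ → Fin a, (∀ i < m, x i = y i) → N x = N y)
    (hm : 0 < m) (y : ℕ → Fin a) : N (extendW hm fun s : Fin m => y s) = N y :=
  hNm _ _ fun _ hi => extendW_prefix_apply hm y hi

theorem conj_mem_Xg (hN : ∀ x, g x / δ = N x) (hN1 : ∀ x, 0 < N x)
    (hNm : ∀ x y : ℕ → Fin a, (∀ i < m, x i = y i) → N x = N y)
    {p : (ℕ → Fin a) × ℤ} (hp : p ∈ discSusp (SFT A) g δ) : conj m g δ p ∈ Xg A g δ hm := by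
  intro n
  have hq := iterate_discT_mem_discSusp hN hN1 hp n
  simp only [conj, Function.iterate_succ_apply']
  obtain ⟨y, j, hyj⟩ := exists_natCast_of_mem_discSusp hq
  rw [hyj] at hq ⊢
  rw [mem_discSusp_iff hN] at hq
  have hroof := roof_extendW_prefix hNm hm y
  refine ⟨⟨y, hq.1, fun i => rfl⟩, ?_, ?_⟩
  · simp only [code, Int.toNat_natCast, hN, hroof]
    exact_mod_cast hq.2
  · rcases (Nat.succ_le_of_lt hq.2).lt_or_eq with h | h
    · rw [discT_of_lt hN h]
      refine Or.inl ⟨rfl, by simp [code], ?_⟩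
      simp only [code, Int.toNat_natCast, hN, hroof]
      exact_mod_cast h
    · rw [discT_of_eq hN h]
      refine Or.inr ⟨?_, by simp [code], fun i h1 h2 => rfl, y, hq.1, fun i => rfl, ?_⟩
      · simp only [code, Int.toNat_natCast, hN, hroof]
        exact_mod_cast h
      · simp only [code, shiftMap]
        congr 1
        omega

theorem iterate_discT_fst (hN : ∀ x, g x / δ = N x) (hN1 : ∀ x, 0 < N x)
    {p : (ℕ → Fin a) × ℤ} (hp : p ∈ discSusp (SFT A) g δ) (n : ℕ) :
    ((discT g δ)^[n] p).1 = (shiftMap a)^[returnCount (conj m g δ p) n] p.1 := by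
  induction n with
  | zero => rfl
  | succ n ih =>
    have hq := iterate_discT_mem_discSusp hN hN1 hp n
    have hlevel : (conj m g δ p (n + 1)).2 = (discT g δ ((discT g δ)^[n] p)).2.toNat := by
      simp only [conj, code, Function.iterate_succ_apply']
    rw [Function.iterate_succ_apply']
    obtain ⟨y, j, hyj⟩ := exists_natCast_of_mem_discSusp hq
    rw [hyj] at hq hlevel ih ⊢
    rw [mem_discSusp_iff hN] at hq
    rcases (Nat.succ_le_of_lt hq.2).lt_or_eq with h | h
    · rw [discT_of_lt hN h] at hlevel ⊢
      rw [returnCount_succ_of_ne (by simp [hlevel])]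
      exact ih
    · rw [discT_of_eq hN h] at hlevel ⊢
      rw [returnCount_succ_of_eq (by simp [hlevel]), Function.iterate_succ_apply', ← ih]

theorem conj_word_apply (hN : ∀ x, g x / δ = N x) (hN1 : ∀ x, 0 < N x)
    {p : (ℕ → Fin a) × ℤ} (hp : p ∈ discSusp (SFT A) g δ) (n : ℕ) (s : Fin m) :
    (conj m g δ p n).1 s = p.1 (returnCount (conj m g δ p) n + s) := by
  have h := iterate_discT_fst (m := m) hN hN1 hp n
  simp only [conj, code] at h ⊢
  rw [h, iterate_shiftMap_apply, add_comm]

/-- A base point sharing enough coordinates with the itinerary of `u` follows `u` up to time `k`. -/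
theorem iterate_discT_eq_of_agree (hN : ∀ x, g x / δ = N x)
    (hNm : ∀ x y : ℕ → Fin a, (∀ i < m, x i = y i) → N x = N y)
    {K : ℕ} (hK : ∀ x, N x ≤ K) {u : ℕ → (Fin m → Fin a) × ℕ} (hu : u ∈ Xg A g δ hm)
    {y : ℕ → Fin a} {k : ℕ} (hy : ∀ i < m + returnCount u k, y i = itinerary hm u i) :
    ∀ n ≤ k, (discT g δ)^[n] (y, ((u 0).2 : ℤ)) =
      ((shiftMap a)^[returnCount u n] y, ((u n).2 : ℤ)) := by
  intro n hn
  induction n with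
  | zero => rfl
  | succ n ih =>
    rw [Function.iterate_succ_apply', ih (by omega)]
    have hmono := returnCount_mono u (show n ≤ k by omega)
    have hroof : N ((shiftMap a)^[returnCount u n] y) = N (extendW hm (u n).1) := by
      refine hNm _ _ fun i hi => ?_
      rw [iterate_shiftMap_apply, hy _ (by omega), extendW_apply hm _ ⟨i, hi⟩,
        word_apply_eq_itinerary hN hK hu, add_comm]
    by_cases h : (u (n + 1)).2 = 0
    · rw [discT_of_eq hN (hroof ▸ (step_of_level_eq_zero hN hu h).1), returnCount_succ_of_eq h, h,
        Function.iterate_succ_apply']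
    · obtain ⟨-, h2, h3⟩ := step_of_level_ne_zero hN hu h
      rw [discT_of_lt hN (hroof ▸ h3), returnCount_succ_of_ne h, h2]

/-- The points of the suspension coded by a cylinder of `X_g` are those over a cylinder of the base,
at a fixed level. -/
theorem conj_preimage_seqCyl (hN : ∀ x, g x / δ = N x) (hN1 : ∀ x, 0 < N x)
    (hNm : ∀ x y : ℕ → Fin a, (∀ i < m, x i = y i) → N x = N y)
    {K : ℕ} (hK : ∀ x, N x ≤ K) {u : ℕ → (Fin m → Fin a) × ℕ} (hu : u ∈ Xg A g δ hm) (k : ℕ) :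
    conj m g δ ⁻¹' seqCyl u (k + 1) ∩ discSusp (SFT A) g δ =
      (SFT A ∩ cyl (itinerary hm u) (m + returnCount u k)) ×ˢ {((u 0).2 : ℤ)} := by
  ext ⟨y, l⟩
  simp only [mem_inter_iff, mem_preimage, mem_prod, mem_singleton_iff]
  constructor
  · rintro ⟨hcyl, hp⟩
    refine ⟨⟨hp.1, fun i hi => ?_⟩, ?_⟩
    · exact (eq_of_windows_eq (fun n s => word_apply_eq_itinerary hN hK hu n s)
        (fun n s => conj_word_apply hN hN1 hp n s) hm (fun n hn => (hcyl n hn).symm) i hi).symm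
    · have h0 := congrArg Prod.snd (hcyl 0 (by omega))
      have h1 : (0 : ℤ) ≤ l := hp.2.1
      simp only [conj, code, Function.iterate_zero, id_eq] at h0
      omega
  · rintro ⟨⟨hyX, hy⟩, rfl⟩
    refine ⟨fun n hn => ?_, ?_⟩
    · have hmono := returnCount_mono u (show n ≤ k by omega)
      simp only [conj, iterate_discT_eq_of_agree hN hNm hK hu hy n (by omega)]
      refine Prod.ext (funext fun s => ?_) (by simp [code])
      have hs := s.2
      simp only [code]
      rw [iterate_shiftMap_apply, hy _ (by omega), word_apply_eq_itinerary hN hK hu, add_comm]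
    · rw [mem_discSusp_iff hN]
      refine ⟨hyX, ?_⟩
      have h := level_lt_of_mem_Xg hN hu 0
      rwa [hNm _ y] at h
      intro i hi
      rw [extendW_apply hm _ ⟨i, hi⟩, word_apply_eq_itinerary hN hK hu, hy i (by omega)]
      simp [returnCount]

end Suspension

section SuspensionMeasure

variable {a m : ℕ} {A : Matrix (Fin a) (Fin a) ℕ} {g : (ℕ → Fin a) → ℝ} {δ : ℝ}
  {N : (ℕ → Fin a) → ℕ}

theorem measurable_of_prefix {β : Type*} [MeasurableSpace β] (hm : 0 < m) {f : (ℕ → Fin a) → β}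
    (hf : ∀ x y : ℕ → Fin a, (∀ i < m, x i = y i) → f x = f y) : Measurable f := by
  have h : f = (fun W : Fin m → Fin a => f (extendW hm W)) ∘ fun x (s : Fin m) => x s :=
    funext fun x => hf _ _ fun i hi => (extendW_prefix_apply hm x hi).symm
  rw [h]
  exact (measurable_of_finite _).comp (by fun_prop)

theorem measurableSet_SFT (A : Matrix (Fin a) (Fin a) ℕ) : MeasurableSet (SFT A) := by
  simp only [SFT, ofPred_forall]
  refine MeasurableSet.iInter fun n => ?_
  have h : Measurable fun x : ℕ → Fin a => (x n, x (n + 1)) := by fun_prop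
  exact h (t := {q | A q.1 q.2 = 1}) MeasurableSet.of_discrete

theorem measurableSet_seqCyl {B : Type*} [MeasurableSpace B] [MeasurableSingletonClass B]
    (u : ℕ → B) (k : ℕ) : MeasurableSet (seqCyl u k) := by
  simp only [seqCyl, ofPred_forall]
  refine MeasurableSet.iInter fun i => MeasurableSet.iInter fun _ => ?_
  have h : Measurable fun v : ℕ → B => v i := measurable_pi_apply i
  exact h (measurableSet_singleton (u i))

theorem measurableSet_Xg (A : Matrix (Fin a) (Fin a) ℕ) (g : (ℕ → Fin a) → ℝ) (δ : ℝ)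
    (hm : 0 < m) : MeasurableSet (Xg A g δ hm) := by
  simp only [Xg, ofPred_forall]
  refine MeasurableSet.iInter fun n => ?_
  have h : Measurable fun u : ℕ → (Fin m → Fin a) × ℕ => (u n, u (n + 1)) := by fun_prop
  exact h (t := {q | wordOK A q.1.1 ∧ ((q.1.2 : ℕ) : ℝ) < g (extendW hm q.1.1) / δ ∧
    transOK A g δ hm q.1 q.2}) (MeasurableSet.of_discrete)

theorem measurable_shiftMap : Measurable (shiftMap a) :=
  measurable_pi_lambda _ fun n => measurable_pi_apply (n + 1)

theorem measurable_shiftSeq {B : Type*} [MeasurableSpace B] :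
    Measurable (shiftSeq : (ℕ → B) → ℕ → B) :=
  measurable_pi_lambda _ fun n => measurable_pi_apply (n + 1)

theorem measurable_discT (hg : Measurable g) : Measurable (discT g δ) := by
  unfold discT
  refine Measurable.ite ?_ (by fun_prop) ?_
  · refine measurableSet_lt ?_ ((hg.comp measurable_fst).div_const δ)
    exact (measurable_of_countable fun z : ℤ => ((z + 1 : ℤ) : ℝ)).comp measurable_snd
  · exact (measurable_shiftMap.comp measurable_fst).prodMk measurable_const

theorem measurable_code : Measurable (code (a := a) m) := by
  unfold code
  exact Measurable.prodMk (by fun_prop) ((measurable_of_countable Int.toNat).comp measurable_snd)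

theorem measurable_conj (hg : Measurable g) : Measurable (conj (a := a) m g δ) :=
  measurable_pi_lambda _ fun n => measurable_code.comp ((measurable_discT hg).iterate n)

theorem measurableSet_discSusp (hg : Measurable g) {X : Set (ℕ → Fin a)} (hX : MeasurableSet X) :
    MeasurableSet (discSusp X g δ) := by
  refine (measurable_fst hX).inter (MeasurableSet.inter ?_ ?_)
  · exact measurableSet_le measurable_const measurable_snd
  · exact measurableSet_lt ((measurable_of_countable fun z : ℤ => (z : ℝ)).comp measurable_snd)
      ((hg.comp measurable_fst).div_const δ)

/-- The suspension measure as an integral over the base of sums over the fibers. -/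
theorem discMeasure_apply (hN : ∀ x, g x / δ = N x) (hg : Measurable g)
    (μ : Measure (ℕ → Fin a)) [SFinite μ] {X : Set (ℕ → Fin a)} (hX : MeasurableSet X)
    (hμX : ∀ᵐ x ∂μ, x ∈ X) {B : Set ((ℕ → Fin a) × ℤ)} (hB : MeasurableSet B) :
    discMeasure μ X g δ B = ENNReal.ofReal (δ / ∫ x, g x ∂μ) *
      ∫⁻ x, ∑ k ∈ Finset.range (N x), B.indicator 1 (x, (k : ℤ)) ∂μ := by
  classical
  simp only [discMeasure, Measure.smul_apply, smul_eq_mul]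
  rw [Measure.restrict_apply hB, Measure.prod_apply (hB.inter (measurableSet_discSusp hg hX))]
  congr 1
  refine lintegral_congr_ae (hμX.mono fun x hx => ?_)
  have h : Prod.mk x ⁻¹' (B ∩ discSusp X g δ) =
      (((Finset.range (N x)).filter fun k : ℕ => (x, (k : ℤ)) ∈ B).map Nat.castEmbedding :
        Finset ℤ) := by
    ext l
    simp only [mem_preimage, mem_inter_iff, Finset.coe_map, Finset.coe_filter, mem_image,
      Finset.mem_range, mem_ofPred_eq, Nat.castEmbedding_apply]
    constructor
    · rintro ⟨hl, hl'⟩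
      obtain ⟨j, rfl⟩ := Int.eq_ofNat_of_zero_le hl'.2.1
      exact ⟨j, ⟨((mem_discSusp_iff hN).1 hl').2, hl⟩, rfl⟩
    · rintro ⟨j, ⟨hj, hjB⟩, rfl⟩
      exact ⟨hjB, (mem_discSusp_iff hN).2 ⟨hx, hj⟩⟩
  simp only [h, Measure.count_apply_finset, Finset.card_map, Finset.card_filter, Nat.cast_sum]
  refine Finset.sum_congr rfl fun k _ => ?_
  by_cases hk : (x, (k : ℤ)) ∈ B <;> simp [hk]

theorem sum_range_indicator_discT (hN : ∀ x, g x / δ = N x) (hN1 : ∀ x, 0 < N x)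
    (B : Set ((ℕ → Fin a) × ℤ)) (x : ℕ → Fin a) :
    (∑ k ∈ Finset.range (N x),
        (discT g δ ⁻¹' B).indicator (1 : (ℕ → Fin a) × ℤ → ENNReal) (x, (k : ℤ))) +
        B.indicator 1 (x, (0 : ℤ)) =
      (∑ k ∈ Finset.range (N x), B.indicator (1 : (ℕ → Fin a) × ℤ → ENNReal) (x, (k : ℤ))) +
        B.indicator 1 (shiftMap a x, (0 : ℤ)) := by
  obtain ⟨n, hn⟩ := Nat.exists_eq_add_of_lt (hN1 x)
  rw [zero_add] at hn
  have hind : ∀ q, (discT g δ ⁻¹' B).indicator (1 : (ℕ → Fin a) × ℤ → ENNReal) q =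
      B.indicator 1 (discT g δ q) := fun q => rfl
  rw [hn, Finset.sum_range_succ, Finset.sum_range_succ' _ n]
  simp only [hind]
  rw [discT_of_eq hN hn.symm, Finset.sum_congr rfl fun k hk => by
    rw [discT_of_lt hN (by have := Finset.mem_range.1 hk; omega)]]
  simp only [Nat.cast_zero]
  ring

/-- The suspension measure over an invariant measure is invariant under the suspension map. -/
theorem discMeasure_preimage_discT (hN : ∀ x, g x / δ = N x) (hN1 : ∀ x, 0 < N x)
    (hg : Measurable g) (μ : Measure (ℕ → Fin a)) [IsFiniteMeasure μ]
    (hinv : MeasurePreserving (shiftMap a) μ μ)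
    {X : Set (ℕ → Fin a)} (hX : MeasurableSet X) (hμX : ∀ᵐ x ∂μ, x ∈ X)
    {B : Set ((ℕ → Fin a) × ℤ)} (hB : MeasurableSet B) :
    discMeasure μ X g δ (discT g δ ⁻¹' B) = discMeasure μ X g δ B := by
  have hTB := measurable_discT (δ := δ) hg hB
  rw [discMeasure_apply hN hg μ hX hμX hTB, discMeasure_apply hN hg μ hX hμX hB]
  congr 1
  have hf : Measurable fun x : ℕ → Fin a => B.indicator (1 : (ℕ → Fin a) × ℤ → ENNReal) (x, (0 : ℤ)) :=
    (measurable_one.indicator hB).comp (by fun_prop)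
  have hfT : Measurable fun x : ℕ → Fin a =>
      B.indicator (1 : (ℕ → Fin a) × ℤ → ENNReal) (shiftMap a x, (0 : ℤ)) :=
    hf.comp measurable_shiftMap
  have hfin : ∫⁻ x, B.indicator (1 : (ℕ → Fin a) × ℤ → ENNReal) (x, (0 : ℤ)) ∂μ ≠ ⊤ := by
    refine ((lintegral_mono (g := fun _ => 1) fun x => ?_).trans_lt ?_).ne
    · exact indicator_le_self _ _ _
    · simp
  have h := lintegral_congr (μ := μ) (sum_range_indicator_discT hN hN1 B)
  rw [lintegral_add_right _ hf, lintegral_add_right _ hfT,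
    hinv.lintegral_comp hf] at h
  exact (ENNReal.add_left_inj hfin).1 h

theorem discMeasure_univ (hN : ∀ x, g x / δ = N x) (hδ : 0 < δ) (hg : Measurable g)
    (μ : Measure (ℕ → Fin a)) [SFinite μ] {X : Set (ℕ → Fin a)} (hX : MeasurableSet X)
    (hμX : ∀ᵐ x ∂μ, x ∈ X) (hint : Integrable g μ) (hpos : 0 < ∫ x, g x ∂μ) :
    discMeasure μ X g δ univ = 1 := by
  rw [discMeasure_apply hN hg μ hX hμX MeasurableSet.univ]
  have h : ∀ x, ∑ k ∈ Finset.range (N x), (univ : Set ((ℕ → Fin a) × ℤ)).indicator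
      (1 : (ℕ → Fin a) × ℤ → ENNReal) (x, (k : ℤ)) = ENNReal.ofReal (g x / δ) := by
    intro x
    simp [hN]
  simp only [h]
  rw [← ofReal_integral_eq_lintegral_ofReal (hint.div_const δ)
    (Eventually.of_forall fun x => by simp [hN]), integral_div, ← ENNReal.ofReal_mul (by positivity)]
  rw [div_mul_div_comm, mul_comm, div_self (by positivity), ENNReal.ofReal_one]

theorem discMeasure_compl_discSusp (hg : Measurable g) (μ : Measure (ℕ → Fin a)) [SFinite μ]
    {X : Set (ℕ → Fin a)} (hX : MeasurableSet X) :
    discMeasure μ X g δ (discSusp X g δ)ᶜ = 0 := by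
  have hS := measurableSet_discSusp (δ := δ) hg hX
  simp [discMeasure, Measure.restrict_apply hS.compl]

/-- The measure of a cylinder of `X_g` is the normalised measure of a cylinder of the base. -/
theorem map_conj_seqCyl {hm : 0 < m} (hN : ∀ x, g x / δ = N x) (hN1 : ∀ x, 0 < N x)
    (hNm : ∀ x y : ℕ → Fin a, (∀ i < m, x i = y i) → N x = N y)
    {K : ℕ} (hK : ∀ x, N x ≤ K) (hg : Measurable g) (μ : Measure (ℕ → Fin a)) [SFinite μ]
    {u : ℕ → (Fin m → Fin a) × ℕ} (hu : u ∈ Xg A g δ hm) (k : ℕ) :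
    Measure.map (conj m g δ) (discMeasure μ (SFT A) g δ) (seqCyl u (k + 1)) =
      ENNReal.ofReal (δ / ∫ x, g x ∂μ) *
        μ (SFT A ∩ cyl (itinerary hm u) (m + returnCount u k)) := by
  have hC := measurableSet_seqCyl u (k + 1)
  rw [Measure.map_apply (measurable_conj hg) hC, discMeasure, Measure.smul_apply, smul_eq_mul,
    Measure.restrict_apply (measurable_conj hg hC), conj_preimage_seqCyl hN hN1 hNm hK hu,
    Measure.prod_prod, Measure.count_singleton, mul_one]

end SuspensionMeasure

section Metric

variable {B : Type*} {θ : ℝ}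

theorem dSeq_nonneg (hθ : 0 ≤ θ) (u v : ℕ → B) : 0 ≤ dSeq θ u v := by
  unfold dSeq
  split_ifs <;> positivity

theorem dSeq_le_pow (hθ0 : 0 ≤ θ) (hθ1 : θ ≤ 1) {u v : ℕ → B} {n : ℕ} (h : ∀ i < n, u i = v i) :
    dSeq θ u v ≤ θ ^ n := by
  unfold dSeq
  split_ifs with huv
  · positivity
  · refine pow_le_pow_of_le_one hθ0 hθ1 ?_
    by_contra! hlt
    exact Nat.sInf_mem (s := {n | u n ≠ v n}) (Function.ne_iff.1 huv) (h _ hlt)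

theorem exists_dSeq_eq_pow {u v : ℕ → B} (huv : u ≠ v) :
    ∃ n, dSeq θ u v = θ ^ n ∧ ∀ i < n, u i = v i := by
  refine ⟨sInf {n | u n ≠ v n}, by simp [dSeq, huv], fun i hi => ?_⟩
  by_contra h
  exact Nat.notMem_of_lt_sInf hi h

end Metric

section Gibbs

variable {a m : ℕ} {A : Matrix (Fin a) (Fin a) ℕ} {g : (ℕ → Fin a) → ℝ} {δ θ : ℝ} {hm : 0 < m}
  {N : (ℕ → Fin a) → ℕ} {φ : (ℕ → Fin a) → ℝ}

/-- The itinerary map is Hölder continuous. -/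
theorem dSeq_itinerary_le (hN : ∀ x, g x / δ = N x) {K : ℕ} (hK : ∀ x, N x ≤ K) (hK0 : 0 < K)
    (hθ0 : 0 < θ) (hθ1 : θ < 1) {u v : ℕ → (Fin m → Fin a) × ℕ} (hu : u ∈ Xg A g δ hm)
    (hv : v ∈ Xg A g δ hm) :
    dSeq θ (itinerary hm u) (itinerary hm v) ≤ dSeq θ u v ^ (1 / K : ℝ) := by
  by_cases huv : u = v
  · subst huv
    simpa [dSeq] using Real.rpow_nonneg (le_refl (0 : ℝ)) ((K : ℝ)⁻¹)
  obtain ⟨n, hn, hagree⟩ := exists_dSeq_eq_pow (θ := θ) huv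
  rw [hn]
  have hroot : ∀ r : ℕ, n ≤ r * K → θ ^ r ≤ (θ ^ n) ^ (1 / K : ℝ) := by
    intro r hr
    have h1 : θ ^ r = ((θ ^ r) ^ K) ^ (1 / K : ℝ) := by
      rw [one_div, Real.pow_rpow_inv_natCast (by positivity) hK0.ne']
    rw [h1, ← pow_mul]
    exact Real.rpow_le_rpow (by positivity) (pow_le_pow_of_le_one hθ0.le hθ1.le hr) (by positivity)
  rcases n with _ | k
  · exact (dSeq_le_pow hθ0.le hθ1.le (n := 0) (by simp)).trans (hroot 0 (by simp))
  · have hlt := lt_returnCount_add_one_mul hN hK hu k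
    refine (dSeq_le_pow hθ0.le hθ1.le fun i hi => ?_).trans (hroot (returnCount u k + 1) hlt)
    exact eq_of_windows_eq (word_apply_eq_itinerary hN hK hu) (word_apply_eq_itinerary hN hK hv)
      hm hagree i (by omega)

theorem exists_abs_le_of_holder (hθ0 : 0 ≤ θ) (hθ1 : θ ≤ 1) {X : Set (ℕ → Fin a)} {C α : ℝ}
    (hC : 0 ≤ C) (hα : 0 ≤ α) (h : ∀ x ∈ X, ∀ y ∈ X, |φ x - φ y| ≤ C * dSeq θ x y ^ α) :
    ∃ M, 0 ≤ M ∧ ∀ x ∈ X, |φ x| ≤ M := by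
  rcases X.eq_empty_or_nonempty with rfl | ⟨z, hz⟩
  · exact ⟨0, le_rfl, by simp⟩
  refine ⟨|φ z| + C, by positivity, fun x hx => ?_⟩
  have h1 : dSeq θ x z ^ α ≤ 1 :=
    Real.rpow_le_one (dSeq_nonneg hθ0 x z)
      ((dSeq_le_pow hθ0 hθ1 (n := 0) (by simp)).trans_eq (pow_zero θ)) hα
  have h2 := (h x hx z hz).trans (mul_le_of_le_one_right hC h1)
  have h3 := abs_sub_abs_le_abs_sub (φ x) (φ z)
  linarith

theorem neg_mul_add_birkhoff_succ (P : ℝ) (n : ℕ) (x : ℕ → Fin a) :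
    -P * (n + 1 : ℕ) + birkhoff φ (n + 1) x =
      -P * n + birkhoff φ n x + (φ ((shiftMap a)^[n] x) - P) := by
  simp only [birkhoff, Finset.sum_range_succ]
  push_cast
  ring

theorem abs_birkhoff_add_sub_le {L P : ℝ} (hL : ∀ x ∈ SFT A, |φ x - P| ≤ L) {x : ℕ → Fin a}
    (hx : x ∈ SFT A) (n d : ℕ) :
    |(-P * (n + d : ℕ) + birkhoff φ (n + d) x) - (-P * n + birkhoff φ n x)| ≤ L * d := by
  induction d with
  | zero => simp
  | succ d ih =>
    rw [← add_assoc, neg_mul_add_birkhoff_succ]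
    have h := hL _ (shiftMap_mem_SFT hx (n + d))
    rw [add_sub_right_comm]
    refine (abs_add_le _ _).trans ?_
    push_cast
    push_cast at ih
    linarith

open Classical in
/-- The potential on `X_g` that charges `φ - P` at the base point when the orbit is about to return
to level `0`, and vanishes elsewhere. -/
def returnPotential (hm : 0 < m) (φ : (ℕ → Fin a) → ℝ) (P : ℝ)
    (u : ℕ → (Fin m → Fin a) × ℕ) : ℝ :=
  if (u 1).2 = 0 then φ (itinerary hm u) - P else 0

theorem sum_returnPotential (hN : ∀ x, g x / δ = N x) {K : ℕ} (hK : ∀ x, N x ≤ K) (P : ℝ)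
    {u : ℕ → (Fin m → Fin a) × ℕ} (hu : u ∈ Xg A g δ hm) (k : ℕ) :
    ∑ i ∈ Finset.range k, returnPotential hm φ P (shiftSeq^[i] u) =
      -P * returnCount u k + birkhoff φ (returnCount u k) (itinerary hm u) := by
  induction k with
  | zero => simp [returnCount, birkhoff]
  | succ k ih =>
    rw [Finset.sum_range_succ, ih, returnPotential, itinerary_iterate_shiftSeq hN hK hu,
      iterate_shiftSeq_apply, add_comm 1 k]
    split_ifs with h
    · rw [returnCount_succ_of_eq h, neg_mul_add_birkhoff_succ]
    · rw [returnCount_succ_of_ne h, add_zero]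

theorem returnPotential_holder (hN : ∀ x, g x / δ = N x) {K : ℕ} (hK : ∀ x, N x ≤ K) (hK0 : 0 < K)
    (hθ0 : 0 < θ) (hθ1 : θ < 1) {C α L P : ℝ} (hC : 0 ≤ C) (hα : 0 ≤ α) (hL0 : 0 ≤ L)
    (hφ : ∀ x ∈ SFT A, ∀ y ∈ SFT A, |φ x - φ y| ≤ C * dSeq θ x y ^ α)
    (hL : ∀ x ∈ SFT A, |φ x - P| ≤ L) {u v : ℕ → (Fin m → Fin a) × ℕ}
    (hu : u ∈ Xg A g δ hm) (hv : v ∈ Xg A g δ hm) :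
    |returnPotential hm φ P u - returnPotential hm φ P v| ≤
      (C + 2 * L / θ ^ (α / K)) * dSeq θ u v ^ (α / K) := by
  have hd := dSeq_nonneg hθ0.le u v
  have hx := itinerary_mem_SFT hN hK hu
  have hy := itinerary_mem_SFT hN hK hv
  have hpow : 0 < θ ^ (α / K) := Real.rpow_pos_of_pos hθ0 _
  have hdpow : 0 ≤ dSeq θ u v ^ (α / K) := Real.rpow_nonneg hd _
  rw [add_mul]
  by_cases h1 : u 1 = v 1
  · have hL' : 0 ≤ 2 * L / θ ^ (α / K) * dSeq θ u v ^ (α / K) := by positivity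
    refine le_trans ?_ (le_add_of_nonneg_right hL')
    unfold returnPotential
    rw [h1]
    split_ifs
    · rw [sub_sub_sub_cancel_right]
      refine (hφ _ hx _ hy).trans (mul_le_mul_of_nonneg_left ?_ hC)
      have h := Real.rpow_le_rpow (dSeq_nonneg hθ0.le _ _)
        (dSeq_itinerary_le hN hK hK0 hθ0 hθ1 hu hv) hα
      rwa [← Real.rpow_mul hd, one_div_mul_eq_div] at h
    · simpa using by positivity
  · have hdist : θ ≤ dSeq θ u v := by
      obtain ⟨n, hn, hagree⟩ := exists_dSeq_eq_pow (θ := θ) (fun h => h1 (congrFun h 1))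
      have hn1 : n ≤ 1 := by
        by_contra! h
        exact h1 (hagree 1 h)
      simpa [hn] using pow_le_pow_of_le_one hθ0.le hθ1.le hn1
    have hbound : ∀ w ∈ Xg A g δ hm, |returnPotential hm φ P w| ≤ L := by
      intro w hw
      unfold returnPotential
      split_ifs
      · exact hL _ (itinerary_mem_SFT hN hK hw)
      · simpa using hL0
    refine le_trans ?_ (le_add_of_nonneg_left (mul_nonneg hC hdpow))
    refine (abs_sub _ _).trans ((add_le_add (hbound u hu) (hbound v hv)).trans ?_)
    rw [div_mul_eq_mul_div, le_div_iff₀ hpow, ← two_mul]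
    exact mul_le_mul_of_nonneg_left
      (Real.rpow_le_rpow hθ0.le hdist (by positivity)) (by positivity)

theorem div_exp_bounds {c₁ c₂ M s t E : ℝ} (h1 : c₁ ≤ M / Real.exp s) (h2 : M / Real.exp s ≤ c₂)
    (hc₁ : 0 ≤ c₁) (hc₂ : 0 ≤ c₂) (hE : |s - t| ≤ E) :
    c₁ * Real.exp (-E) ≤ M / Real.exp t ∧ M / Real.exp t ≤ c₂ * Real.exp E := by
  have h : M / Real.exp t = M / Real.exp s * Real.exp (s - t) := by
    rw [Real.exp_sub]
    field_simp
  obtain ⟨h3, h4⟩ := abs_le.1 hE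
  rw [h]
  exact ⟨mul_le_mul h1 (Real.exp_le_exp.2 h3) (Real.exp_pos _).le (hc₁.trans h1),
    mul_le_mul h2 (Real.exp_le_exp.2 h4) (Real.exp_pos _).le hc₂⟩

end Gibbs

/-- The measure `μ̃^g` transported to the discretised subshift `X_g` is a
`σ_g`-invariant Borel probability measure, and it is the Gibbs measure (equilibrium state)
of some `d_θ`-Hölder continuous potential `ψ : X_g → ℝ`. -/
theorem discretised_measure_gibbs
    (a : ℕ) (ha : 2 ≤ a) (A : Matrix (Fin a) (Fin a) ℕ)
    (hA01 : ∀ i j, A i j = 0 ∨ A i j = 1)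
    (hAper : ∃ d : ℕ, 0 < d ∧ ∀ i j, 0 < (A ^ d) i j)
    (θ : ℝ) (hθ : θ ∈ Set.Ioo (0 : ℝ) 1)
    (φ : (ℕ → Fin a) → ℝ)
    (hφHolder : ∃ C α : ℝ, 0 < C ∧ 0 < α ∧ ∀ x ∈ SFT A, ∀ y ∈ SFT A,
        |φ x - φ y| ≤ C * dSeq θ x y ^ α)
    (μ : Measure (ℕ → Fin a)) [IsProbabilityMeasure μ]
    (hsupp : μ (SFT A) = 1)
    (hinv : ∀ B : Set (ℕ → Fin a), MeasurableSet B → μ (shiftMap a ⁻¹' B) = μ B)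
    (P : ℝ) (hP : 0 ≤ P) (c₁ c₂ : ℝ) (hc₁ : 0 < c₁) (hc₂ : 0 < c₂)
    (hGibbs : ∀ x ∈ SFT A, ∀ n : ℕ, 1 ≤ n →
        c₁ ≤ (μ (SFT A ∩ cyl x n)).toReal / Real.exp (-P * n + birkhoff φ n x) ∧
        (μ (SFT A ∩ cyl x n)).toReal / Real.exp (-P * n + birkhoff φ n x) ≤ c₂)
    (δ : ℝ) (hδ : 0 < δ) (m : ℕ) (hm : 0 < m)
    (g : (ℕ → Fin a) → ℝ)
    (hgconst : ∀ x y : ℕ → Fin a, (∀ i < m, x i = y i) → g x = g y)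
    (hgval : ∀ x : ℕ → Fin a, ∃ j : ℤ, g x = j * δ)
    (hgδ : ∀ x : ℕ → Fin a, δ ≤ g x) :
    IsProbabilityMeasure (Measure.map (conj m g δ) (discMeasure μ (SFT A) g δ)) ∧
    (Measure.map (conj m g δ) (discMeasure μ (SFT A) g δ)) (Xg A g δ hm) = 1 ∧
    (∀ B : Set (ℕ → ((Fin m → Fin a) × ℕ)), MeasurableSet B →
        (Measure.map (conj m g δ) (discMeasure μ (SFT A) g δ)) (shiftSeq ⁻¹' B) =
          (Measure.map (conj m g δ) (discMeasure μ (SFT A) g δ)) B) ∧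
    ∃ ψ : (ℕ → ((Fin m → Fin a) × ℕ)) → ℝ, ∃ Cψ αψ P' C₁ C₂ : ℝ,
      0 < Cψ ∧ 0 < αψ ∧ 0 ≤ P' ∧ 0 < C₁ ∧ 0 < C₂ ∧
      (∀ xb ∈ Xg A g δ hm, ∀ yb ∈ Xg A g δ hm,
          |ψ xb - ψ yb| ≤ Cψ * dSeq θ xb yb ^ αψ) ∧
      (∀ xb ∈ Xg A g δ hm, ∀ k : ℕ, 1 ≤ k →
          C₁ ≤ ((Measure.map (conj m g δ) (discMeasure μ (SFT A) g δ)) (seqCyl xb k)).toReal /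
              Real.exp (-P' * k + ∑ i ∈ Finset.range k, ψ (shiftSeq^[i] xb)) ∧
          ((Measure.map (conj m g δ) (discMeasure μ (SFT A) g δ)) (seqCyl xb k)).toReal /
              Real.exp (-P' * k + ∑ i ∈ Finset.range k, ψ (shiftSeq^[i] xb)) ≤ C₂) := by
  have hg : Measurable g := measurable_of_prefix hm hgconst
  have hNex : ∀ x, ∃ n : ℕ, g x / δ = n ∧ 0 < n := by
    intro x
    obtain ⟨j, hj⟩ := hgval x
    have h1 : (0 : ℝ) < j := by
      have := hδ.trans_le (hgδ x)
      rw [hj] at this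
      exact pos_of_mul_pos_left this hδ.le
    have h2 : 0 < j := by exact_mod_cast h1
    obtain ⟨n, rfl⟩ := Int.eq_ofNat_of_zero_le h2.le
    refine ⟨n, ?_, by exact_mod_cast h2⟩
    rw [hj, mul_div_cancel_right₀ _ hδ.ne']
    simp
  choose N hN hN1 using hNex
  have hNm : ∀ x y : ℕ → Fin a, (∀ i < m, x i = y i) → N x = N y := by
    intro x y hxy
    have h := hN x
    rw [hgconst x y hxy, hN y] at h
    exact_mod_cast h.symm
  obtain ⟨K, hK, hK0⟩ : ∃ K, (∀ x, N x ≤ K) ∧ 0 < K := by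
    obtain ⟨K, hK⟩ := (Set.finite_range fun W : Fin m → Fin a => N (extendW hm W)).bddAbove
    refine ⟨K + 1, fun x => ?_, Nat.succ_pos K⟩
    rw [← roof_extendW_prefix hNm hm x]
    exact (hK (mem_range_self _)).trans (Nat.le_succ K)
  have hX := measurableSet_SFT A
  have hμX : ∀ᵐ x ∂μ, x ∈ SFT A := (mem_ae_iff_prob_eq_one hX).2 hsupp
  have hgN : ∀ x, g x = N x * δ := fun x => (div_eq_iff hδ.ne').1 (hN x)
  have hint : Integrable g μ := by
    refine Integrable.of_bound hg.aestronglyMeasurable (K * δ) (Eventually.of_forall fun x => ?_)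
    rw [Real.norm_of_nonneg (hδ.le.trans (hgδ x)), hgN]
    have := hK x
    gcongr
  have hpos : 0 < ∫ x, g x ∂μ := by
    have h := integral_mono (integrable_const δ) hint hgδ
    simp only [integral_const, probReal_univ, one_smul] at h
    exact hδ.trans_le h
  have hconj : Measurable (conj m g δ) := measurable_conj hg
  have hprob : IsProbabilityMeasure (discMeasure μ (SFT A) g δ) :=
    ⟨discMeasure_univ hN hδ hg μ hX hμX hint hpos⟩
  have hmap : IsProbabilityMeasure (Measure.map (conj m g δ) (discMeasure μ (SFT A) g δ)) :=
    Measure.isProbabilityMeasure_map hconj.aemeasurable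
  have hshift : MeasurePreserving (shiftMap a) μ μ :=
    ⟨measurable_shiftMap, Measure.ext fun B hB => by
      rw [Measure.map_apply measurable_shiftMap hB, hinv B hB]⟩
  refine ⟨hmap, ?_, fun B hB => ?_, ?_⟩
  · have hXg := measurableSet_Xg A g δ hm
    rw [← prob_compl_eq_zero_iff hXg, Measure.map_apply hconj hXg.compl]
    have hsub : discSusp (SFT A) g δ ⊆ conj m g δ ⁻¹' Xg A g δ hm := fun p hp =>
      conj_mem_Xg hN hN1 hNm hp
    exact measure_mono_null (compl_subset_compl.2 hsub) (discMeasure_compl_discSusp hg μ hX)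
  · rw [Measure.map_apply hconj (measurable_shiftSeq hB), Measure.map_apply hconj hB,
      ← discMeasure_preimage_discT hN hN1 hg μ hshift hX hμX (hconj hB)]
    congr 1
  · obtain ⟨C, α, hC, hα, hφ⟩ := hφHolder
    obtain ⟨hθ0, hθ1⟩ := hθ
    obtain ⟨M, hM0, hM⟩ := exists_abs_le_of_holder hθ0.le hθ1.le hC.le hα.le hφ
    have hL : ∀ x ∈ SFT A, |φ x - P| ≤ M + P := fun x hx =>
      (abs_sub _ _).trans (add_le_add (hM x hx) (abs_of_nonneg hP).le)
    have hL0 : 0 ≤ M + P := add_nonneg hM0 hP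
    have hD : 0 < δ / ∫ x, g x ∂μ := div_pos hδ hpos
    have hθpow : 0 < θ ^ (α / K) := Real.rpow_pos_of_pos hθ0 _
    refine ⟨returnPotential hm φ P, C + 2 * (M + P) / θ ^ (α / K), α / K, 0,
      (δ / ∫ x, g x ∂μ) * (c₁ * Real.exp (-((M + P) * m))),
      (δ / ∫ x, g x ∂μ) * (c₂ * Real.exp ((M + P) * m)), by positivity, by positivity, le_rfl,
      by positivity, by positivity,
      fun u hu v hv => returnPotential_holder hN hK hK0 hθ0 hθ1 hC.le hα.le hL0 hφ hL hu hv,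
      fun u hu k hk => ?_⟩
    obtain ⟨k, rfl⟩ := Nat.exists_eq_add_of_le' hk
    have hx := itinerary_mem_SFT hN hK hu
    rw [map_conj_seqCyl hN hN1 hNm hK hg μ hu, sum_returnPotential hN hK P hu, neg_zero, zero_mul,
      zero_add, ENNReal.toReal_mul, ENNReal.toReal_ofReal hD.le, mul_div_assoc]
    obtain ⟨d, hd⟩ : ∃ d, m + returnCount u k = returnCount u (k + 1) + d :=
      Nat.exists_eq_add_of_le (by have := returnCount_succ_le u k; omega)
    have hdm : (d : ℝ) ≤ m := by
      have := returnCount_mono u (k.le_add_right 1)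
      exact_mod_cast (by omega : d ≤ m)
    obtain ⟨h1, h2⟩ := hGibbs _ hx (m + returnCount u k) (by omega)
    have hE : |(-P * (m + returnCount u k : ℕ) +
          birkhoff φ (m + returnCount u k) (itinerary hm u)) -
        (-P * returnCount u (k + 1) + birkhoff φ (returnCount u (k + 1)) (itinerary hm u))| ≤
        (M + P) * m := by
      rw [hd]
      exact (abs_birkhoff_add_sub_le hL hx _ d).trans (mul_le_mul_of_nonneg_left hdm hL0)
    obtain ⟨h3, h4⟩ := div_exp_bounds h1 h2 hc₁.le hc₂.le hE
    exact ⟨mul_le_mul_of_nonneg_left h3 hD.le, mul_le_mul_of_nonneg_left h4 hD.le⟩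

end
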